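/- (Disk failures, finite-blocklength guessing version.) For every pair (p, r) ∈ {0,…,s}² satisfying p + r = s and p, r ∈ {0} ∪ {⌈log δ⌉, ⌈log δ⌉ + 1, …}, there is a choice of Alice's encoder (a conditional PMF on (𝔽_{2^s})^δ given (X,Y)) for which Bob's guessing ambiguity satisfies 𝒜_B^g < 1 + 2^{ρ(H_{1/(1+ρ)}(X|Y) − νs + ηr + 1)} and Eve's ambiguity satisfies 𝒜_E ≥ 2^{ρ(H_{1/(1+ρ)}(X|Y) − η(s − r) − η·log δ − log(1 + ln|𝒳|))}. Conversely, for every choice of Alice's encoder, 𝒜_B^g ≥ max( 2^{ρ(H_{1/(1+ρ)}(X|Y) − νs − log(1 + ln|𝒳|))}, 1 ) and 𝒜_E ≤ min( 2^{ρ(ν − η)s} · 𝒜_B^g, 2^{ρ H_{1/(1+ρ)}(X|Y)} ). -/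

import Mathlib

open scoped BigOperators

noncomputable section

/-- `G` is a guessing function for `X` given side information in `V`:
for every `v`, `G v` is a bijection from `X` onto `{1, …, |X|}`. -/
def IsGuess {X V : Type*} [Fintype X] (G : V → X → ℕ) : Prop :=
  ∀ v : V, Set.BijOn (G v) Set.univ (Set.Icc 1 (Fintype.card X))

/-- The conditional Rényi entropy `H_α(X|Y)` (base 2) of order `α = 1/(1+ρ)`. -/
def condRenyi {X Y : Type*} [Fintype X] [Fintype Y] (ρ : ℝ) (p : X → Y → ℝ) : ℝ :=
  ((1 / (1 + ρ)) / (1 - 1 / (1 + ρ))) *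
    Real.logb 2 (∑ y : Y, (∑ x : X, p x y ^ (1 / (1 + ρ))) ^ (1 / (1 / (1 + ρ)))) 

/-- Bob's (min-max) guessing ambiguity in the distributed-storage system with `δ` disks of
`s` bits each, of which Bob sees the `ν` that maximize his ambiguity. -/
def bobGuessAmbDF {𝒳 𝒴 : Type*} [Fintype 𝒳] [Fintype 𝒴] (δ ν s : ℕ)
    (ρ : ℝ) (p : 𝒳 → 𝒴 → ℝ) (e : 𝒳 → 𝒴 → (Fin δ → Fin (2 ^ s)) → ℝ) : ℝ :=
  sInf {r : ℝ |
    ∃ G : (B : Finset (Fin δ)) → 𝒴 × ({i // i ∈ B} → Fin (2 ^ s)) → 𝒳 → ℕ,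
      (∀ B : Finset (Fin δ), B.card = ν → IsGuess (G B)) ∧
      r = ∑ x : 𝒳, ∑ y : 𝒴, ∑ m : Fin δ → Fin (2 ^ s), p x y * e x y m *
        ((sSup {k : ℕ | ∃ B : Finset (Fin δ), B.card = ν ∧
            k = G B (y, fun i => m i.1) x} : ℕ) : ℝ) ^ ρ}

/-- Eve's (min-min) guessing ambiguity in the distributed-storage system: Eve sees the `η`
hints that minimize her ambiguity. -/
def eveAmbDF {𝒳 𝒴 : Type*} [Fintype 𝒳] [Fintype 𝒴] (δ η s : ℕ)
    (ρ : ℝ) (p : 𝒳 → 𝒴 → ℝ) (e : 𝒳 → 𝒴 → (Fin δ → Fin (2 ^ s)) → ℝ) : ℝ :=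
  sInf {r : ℝ |
    ∃ G : (B : Finset (Fin δ)) → 𝒴 × ({i // i ∈ B} → Fin (2 ^ s)) → 𝒳 → ℕ,
      (∀ B : Finset (Fin δ), B.card = η → IsGuess (G B)) ∧
      r = ∑ x : 𝒳, ∑ y : 𝒴, ∑ m : Fin δ → Fin (2 ^ s), p x y * e x y m *
        ((sInf {k : ℕ | ∃ B : Finset (Fin δ), B.card = η ∧
            k = G B (y, fun i => m i.1) x} : ℕ) : ℝ) ^ ρ}

/-! ### Guessing orders -/

/-- Sorting by `f` produces a guessing order in which `x` comes no later than the number of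
elements whose `f`-value does not exceed that of `x`. -/
lemma exists_guess_le_card {X L : Type*} [Fintype X] [LinearOrder L] (f : X → L) :
    ∃ g : X → ℕ, Set.BijOn g Set.univ (Set.Icc 1 (Fintype.card X)) ∧
      ∀ x, g x ≤ (Finset.univ.filter fun x' => f x' ≤ f x).card := by
  classical
  let k : X → L ×ₗ Fin (Fintype.card X) := fun x => toLex (f x, Fintype.equivFin X x)
  have hk : Function.Injective k := by
    intro a b h
    have h2 := congrArg (fun z => (ofLex z).2) h
    exact (Fintype.equivFin X).injective h2
  let g : X → ℕ := fun x => (Finset.univ.filter fun x' => k x' ≤ k x).card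
  have hlt : ∀ a b, k a < k b → g a < g b := by
    intro a b h
    apply Finset.card_lt_card
    refine (Finset.ssubset_iff_of_subset ?_).2 ⟨b, by simp, by simpa using h⟩
    intro c
    simp only [Finset.mem_filter, Finset.mem_univ, true_and]
    exact fun hc => hc.trans h.le
  have hg : Function.Injective g := by
    intro a b h
    rcases lt_trichotomy (k a) (k b) with h' | h' | h'
    · exact absurd h (hlt _ _ h').ne
    · exact hk h'
    · exact absurd h (hlt _ _ h').ne'
  have hmem : ∀ x, g x ∈ Finset.Icc 1 (Fintype.card X) := by
    intro x
    rw [Finset.mem_Icc]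
    exact ⟨Finset.card_pos.2 ⟨x, by simp⟩, Finset.card_le_univ _⟩
  refine ⟨g, ⟨fun x _ => by simpa using hmem x, hg.injOn, ?_⟩, ?_⟩
  · have himg : Finset.univ.image g = Finset.Icc 1 (Fintype.card X) := by
      apply Finset.eq_of_subset_of_card_le
      · intro n hn
        obtain ⟨x, -, rfl⟩ := Finset.mem_image.1 hn
        exact hmem x
      · rw [Finset.card_image_of_injective _ hg]
        simp
    intro n hn
    have : n ∈ Finset.univ.image g := by rw [himg]; simpa using hn
    obtain ⟨x, -, hx⟩ := Finset.mem_image.1 this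
    exact ⟨x, Set.mem_univ _, hx⟩
  · intro x
    apply Finset.card_le_card
    intro c
    simp only [Finset.mem_filter, Finset.mem_univ, true_and]
    intro hc
    rcases (Prod.Lex.le_iff).1 hc with h | h
    · exact le_of_lt h
    · exact le_of_eq h.1

lemma exists_isGuess (X V : Type*) [Fintype X] : ∃ G : V → X → ℕ, IsGuess G := by
  obtain ⟨g, hg, -⟩ := exists_guess_le_card (fun _ : X => (0 : ℕ))
  exact ⟨fun _ => g, fun _ => hg⟩

lemma IsGuess.one_le {X V : Type*} [Fintype X] {G : V → X → ℕ} (hG : IsGuess G) (v : V) (x : X) :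
    1 ≤ G v x :=
  ((hG v).mapsTo (Set.mem_univ x)).1

lemma sum_inv_guess_le {X : Type*} [Fintype X] {g : X → ℕ}
    (hg : Set.BijOn g Set.univ (Set.Icc 1 (Fintype.card X))) :
    ∑ x, ((g x : ℝ))⁻¹ ≤ 1 + Real.log (Fintype.card X) := by
  have h : ∑ x, ((g x : ℝ))⁻¹ = ∑ k ∈ Finset.Icc 1 (Fintype.card X), ((k : ℝ))⁻¹ := by
    refine Finset.sum_bij (fun x _ => g x) ?_ ?_ ?_ ?_
    · intro x _
      simpa using hg.mapsTo (Set.mem_univ x)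
    · intro a _ b _ h
      exact hg.injOn (Set.mem_univ _) (Set.mem_univ _) h
    · intro n hn
      obtain ⟨x, -, hx⟩ := hg.surjOn (by simpa using hn : n ∈ Set.Icc 1 (Fintype.card X))
      exact ⟨x, Finset.mem_univ _, hx⟩
    · intro x _
      rfl
  rw [h]
  have := harmonic_le_one_add_log (Fintype.card X)
  rw [harmonic_eq_sum_Icc] at this
  push_cast at this
  exact this

/-! ### Rényi entropy and guessing moments -/

lemma two_rpow_mul_condRenyi {X Y : Type*} [Fintype X] [Fintype Y] {ρ : ℝ} (hρ : 0 < ρ)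
    {p : X → Y → ℝ} (hp0 : ∀ x y, 0 ≤ p x y) (hp1 : ∑ x, ∑ y, p x y = 1) :
    (2 : ℝ) ^ (ρ * condRenyi ρ p) = ∑ y, (∑ x, p x y ^ (1 / (1 + ρ))) ^ (1 + ρ) := by
  have hpos : 0 < ∑ y, (∑ x, p x y ^ (1 / (1 + ρ))) ^ (1 + ρ) := by
    obtain ⟨x, -, hx⟩ := Finset.exists_ne_zero_of_sum_ne_zero (by rw [hp1]; exact one_ne_zero)
    obtain ⟨y, -, hy⟩ := Finset.exists_ne_zero_of_sum_ne_zero hx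
    have hxy : 0 < p x y := lt_of_le_of_ne (hp0 x y) (Ne.symm hy)
    refine Finset.sum_pos' (fun y _ => ?_) ⟨y, Finset.mem_univ _, ?_⟩
    · exact Real.rpow_nonneg (Finset.sum_nonneg fun x _ => Real.rpow_nonneg (hp0 x y) _) _
    · refine Real.rpow_pos_of_pos (Finset.sum_pos' (fun x _ => Real.rpow_nonneg (hp0 x y) _)
        ⟨x, Finset.mem_univ _, Real.rpow_pos_of_pos hxy _⟩) _
  have h1 : ρ * ((1 / (1 + ρ)) / (1 - 1 / (1 + ρ))) = 1 := by
    have h0 : 1 + ρ ≠ 0 := by positivity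
    have h2 : 1 - 1 / (1 + ρ) = ρ / (1 + ρ) := by field_simp; ring
    rw [h2]
    field_simp
  unfold condRenyi
  rw [← mul_assoc, h1, one_mul, one_div_one_div,
    Real.rpow_logb (by norm_num) (by norm_num) hpos]

/-- Arıkan's upper bound: guessing in decreasing order of probability. -/
lemma sum_mul_guess_rpow_le {X : Type*} [Fintype X] {ρ : ℝ} (hρ : 0 < ρ) {P : X → ℝ}
    (hP : ∀ x, 0 ≤ P x) {g : X → ℕ}
    (hg : ∀ x, g x ≤ (Finset.univ.filter fun x' => -P x' ≤ -P x).card) :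
    ∑ x, P x * (g x : ℝ) ^ ρ ≤ (∑ x, P x ^ (1 / (1 + ρ))) ^ (1 + ρ) := by
  set S := ∑ x, P x ^ (1 / (1 + ρ)) with hS
  have hS0 : 0 ≤ S := Finset.sum_nonneg fun x _ => Real.rpow_nonneg (hP x) _
  have key : ∀ x, P x * (g x : ℝ) ^ ρ ≤ S ^ ρ * P x ^ (1 / (1 + ρ)) := by
    intro x
    rcases (hP x).eq_or_lt with h0 | h0
    · rw [← h0, zero_mul]
      exact mul_nonneg (Real.rpow_nonneg hS0 _) (Real.rpow_nonneg le_rfl _)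
    · have hpow : 0 < P x ^ (1 / (1 + ρ)) := Real.rpow_pos_of_pos h0 _
      have hgS : (g x : ℝ) ≤ S / P x ^ (1 / (1 + ρ)) := by
        rw [le_div_iff₀ hpow]
        calc (g x : ℝ) * P x ^ (1 / (1 + ρ))
            ≤ ((Finset.univ.filter fun x' => -P x' ≤ -P x).card : ℝ) * P x ^ (1 / (1 + ρ)) := by
              gcongr
              exact hg x
          _ = ∑ x' ∈ Finset.univ.filter (fun x' => -P x' ≤ -P x), P x ^ (1 / (1 + ρ)) := by
              rw [Finset.sum_const, nsmul_eq_mul]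
          _ ≤ ∑ x' ∈ Finset.univ.filter (fun x' => -P x' ≤ -P x), P x' ^ (1 / (1 + ρ)) := by
              refine Finset.sum_le_sum fun x' hx' => ?_
              refine Real.rpow_le_rpow h0.le ?_ (by positivity)
              simpa using hx'
          _ ≤ S := Finset.sum_le_univ_sum_of_nonneg fun x' => Real.rpow_nonneg (hP x') _
      calc P x * (g x : ℝ) ^ ρ ≤ P x * (S / P x ^ (1 / (1 + ρ))) ^ ρ := by gcongr
        _ = S ^ ρ * P x ^ (1 / (1 + ρ)) := by
          rw [Real.div_rpow hS0 hpow.le, ← Real.rpow_mul h0.le]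
          have : P x = P x ^ (1 / (1 + ρ)) * P x ^ (1 / (1 + ρ) * ρ) := by
            rw [← Real.rpow_add h0]
            conv_lhs => rw [← Real.rpow_one (P x)]
            congr 1
            field_simp
          have hne : P x ^ (1 / (1 + ρ) * ρ) ≠ 0 := (Real.rpow_pos_of_pos h0 _).ne'
          rw [mul_div_assoc', div_eq_iff hne, mul_assoc, ← this, mul_comm]
  calc ∑ x, P x * (g x : ℝ) ^ ρ ≤ ∑ x, S ^ ρ * P x ^ (1 / (1 + ρ)) :=
        Finset.sum_le_sum fun x _ => key x
    _ = S ^ ρ * S := by rw [← Finset.mul_sum]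
    _ = S ^ (1 + ρ) := by
      rw [add_comm, Real.rpow_add_one' hS0 (by positivity)]

/-- The Hölder inequality behind Arıkan's lower bound on guessing moments. -/
lemma sum_weight_rpow_le {ι : Type*} (t : Finset ι) {ρ : ℝ} (hρ : 0 < ρ) {w P a : ι → ℝ}
    (hw : ∀ i, 0 ≤ w i) (hP : ∀ i, 0 ≤ P i) (ha : ∀ i, 0 < a i) :
    (∑ i ∈ t, w i * P i ^ (1 / (1 + ρ))) ^ (1 + ρ) ≤
      (∑ i ∈ t, P i * w i * a i ^ ρ) * (∑ i ∈ t, w i * (a i)⁻¹) ^ ρ := by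
  have h1ρ : 0 < 1 + ρ := by positivity
  have hconj : (1 + ρ).HolderConjugate ((1 + ρ) / ρ) := by
    rw [Real.holderConjugate_iff]
    refine ⟨by linarith, ?_⟩
    field_simp
  have hA : ∀ i, 0 ≤ P i * w i * a i ^ ρ := fun i =>
    mul_nonneg (mul_nonneg (hP i) (hw i)) (Real.rpow_nonneg (ha i).le _)
  have hB : ∀ i, 0 ≤ w i * (a i)⁻¹ := fun i => mul_nonneg (hw i) (inv_nonneg.2 (ha i).le)
  have h := Real.inner_le_Lp_mul_Lq_of_nonneg t hconj
    (f := fun i => (P i * w i * a i ^ ρ) ^ (1 / (1 + ρ)))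
    (g := fun i => (w i * (a i)⁻¹) ^ (ρ / (1 + ρ)))
    (fun i _ => Real.rpow_nonneg (hA i) _) (fun i _ => Real.rpow_nonneg (hB i) _)
  have e1 : ∀ i, (P i * w i * a i ^ ρ) ^ (1 / (1 + ρ)) * (w i * (a i)⁻¹) ^ (ρ / (1 + ρ)) =
      w i * P i ^ (1 / (1 + ρ)) := by
    intro i
    rw [Real.mul_rpow (mul_nonneg (hP i) (hw i)) (Real.rpow_nonneg (ha i).le _),
      Real.mul_rpow (hP i) (hw i), Real.mul_rpow (hw i) (inv_nonneg.2 (ha i).le),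
      Real.inv_rpow (ha i).le, ← Real.rpow_mul (ha i).le]
    have hwi : w i ^ (1 / (1 + ρ)) * w i ^ (ρ / (1 + ρ)) = w i := by
      have hexp : 1 / (1 + ρ) + ρ / (1 + ρ) = 1 := by field_simp
      rw [← Real.rpow_add' (hw i) (by rw [hexp]; exact one_ne_zero), hexp, Real.rpow_one]
    have hai : a i ^ (ρ * (1 / (1 + ρ))) * (a i ^ (ρ / (1 + ρ)))⁻¹ = 1 := by
      rw [mul_one_div]
      exact mul_inv_cancel₀ (Real.rpow_pos_of_pos (ha i) _).ne'
    calc _ = P i ^ (1 / (1 + ρ)) * (w i ^ (1 / (1 + ρ)) * w i ^ (ρ / (1 + ρ))) *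
          (a i ^ (ρ * (1 / (1 + ρ))) * (a i ^ (ρ / (1 + ρ)))⁻¹) := by ring
      _ = _ := by rw [hwi, hai]; ring
  have e2 : ∀ i, ((P i * w i * a i ^ ρ) ^ (1 / (1 + ρ))) ^ (1 + ρ) = P i * w i * a i ^ ρ := by
    intro i
    rw [← Real.rpow_mul (hA i), one_div_mul_cancel h1ρ.ne', Real.rpow_one]
  have e3 : ∀ i, ((w i * (a i)⁻¹) ^ (ρ / (1 + ρ))) ^ ((1 + ρ) / ρ) = w i * (a i)⁻¹ := by
    intro i
    rw [← Real.rpow_mul (hB i), div_mul_div_cancel₀ h1ρ.ne', div_self hρ.ne', Real.rpow_one]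
  simp only [e1, e2, e3] at h
  have hA' := Finset.sum_nonneg fun i (_ : i ∈ t) => hA i
  have hB' := Finset.sum_nonneg fun i (_ : i ∈ t) => hB i
  calc (∑ i ∈ t, w i * P i ^ (1 / (1 + ρ))) ^ (1 + ρ)
      ≤ ((∑ i ∈ t, P i * w i * a i ^ ρ) ^ (1 / (1 + ρ)) *
          (∑ i ∈ t, w i * (a i)⁻¹) ^ (1 / ((1 + ρ) / ρ))) ^ (1 + ρ) := by
        refine Real.rpow_le_rpow (Finset.sum_nonneg fun i _ => ?_) h h1ρ.le
        exact mul_nonneg (hw i) (Real.rpow_nonneg (hP i) _)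
    _ = _ := by
        rw [Real.mul_rpow (Real.rpow_nonneg hA' _) (Real.rpow_nonneg hB' _),
          ← Real.rpow_mul hA', ← Real.rpow_mul hB', one_div_mul_cancel h1ρ.ne', Real.rpow_one]
        congr 2
        field_simp

/-- Arıkan's lower bound for a generalized guessing cost `a`: if the expected reciprocal cost
summed over `x` is at most `K`, then the `ρ`-th moment of `a` is at least `2 ^ (ρ H) / K ^ ρ`. -/
lemma two_rpow_condRenyi_le_moment_mul {X Y M : Type*} [Fintype X] [Fintype Y] [Fintype M]
    {ρ : ℝ} (hρ : 0 < ρ) {p : X → Y → ℝ} (hp0 : ∀ x y, 0 ≤ p x y)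
    (hp1 : ∑ x, ∑ y, p x y = 1) {e : X → Y → M → ℝ} (he0 : ∀ x y m, 0 ≤ e x y m)
    (he1 : ∀ x y, ∑ m, e x y m = 1) {a : X → Y → M → ℝ} (ha : ∀ x y m, 0 < a x y m) {K : ℝ}
    (hK : ∀ y, ∑ x, ∑ m, e x y m * (a x y m)⁻¹ ≤ K) :
    (2 : ℝ) ^ (ρ * condRenyi ρ p) ≤
      (∑ x, ∑ y, ∑ m, p x y * e x y m * a x y m ^ ρ) * K ^ ρ := by
  rw [two_rpow_mul_condRenyi hρ hp0 hp1, Finset.sum_comm, Finset.sum_mul]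
  refine Finset.sum_le_sum fun y _ => ?_
  have h := sum_weight_rpow_le (Finset.univ : Finset (X × M)) hρ (w := fun i => e i.1 y i.2)
    (P := fun i => p i.1 y) (a := fun i => a i.1 y i.2) (fun i => he0 _ _ _)
    (fun i => hp0 _ _) (fun i => ha _ _ _)
  simp only [Fintype.sum_prod_type] at h
  have hsum : ∀ x, ∑ m, e x y m * p x y ^ (1 / (1 + ρ)) = p x y ^ (1 / (1 + ρ)) := by
    intro x
    rw [← Finset.sum_mul, he1, one_mul]
  simp only [hsum] at h
  refine h.trans (mul_le_mul_of_nonneg_left (Real.rpow_le_rpow ?_ (hK y) hρ.le) ?_)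
  · exact Finset.sum_nonneg fun x _ => Finset.sum_nonneg fun m _ =>
      mul_nonneg (he0 _ _ _) (inv_nonneg.2 (ha _ _ _).le)
  · exact Finset.sum_nonneg fun x _ => Finset.sum_nonneg fun m _ =>
      mul_nonneg (mul_nonneg (hp0 _ _) (he0 _ _ _)) (Real.rpow_nonneg (ha _ _ _).le _)

/-- If given `x` every value of the observed hints has probability at most `c`, the expected
reciprocal of the number of guesses summed over `x` is at most
`c * 2 ^ (s * |S|) * (1 + log |X|)`. -/
lemma sum_inv_guess_of_hints_le {X : Type*} [Fintype X] {δ s : ℕ} (S : Finset (Fin δ))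
    {e : X → (Fin δ → Fin (2 ^ s)) → ℝ} {c : ℝ} (hc : 0 ≤ c)
    (hec : ∀ x (w : {i // i ∈ S} → Fin (2 ^ s)),
      ∑ m ∈ Finset.univ.filter (fun m : Fin δ → Fin (2 ^ s) => (fun i : {i // i ∈ S} => m i.1) = w),
        e x m ≤ c)
    {g : ({i // i ∈ S} → Fin (2 ^ s)) → X → ℕ} (hg : IsGuess g) :
    ∑ x, ∑ m, e x m * ((g (fun i => m i.1) x : ℝ))⁻¹ ≤
      c * 2 ^ (s * S.card) * (1 + Real.log (Fintype.card X)) := by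
  have hfib : ∀ x, ∑ m, e x m * ((g (fun i => m i.1) x : ℝ))⁻¹ ≤
      ∑ w : {i // i ∈ S} → Fin (2 ^ s), c * ((g w x : ℝ))⁻¹ := by
    intro x
    rw [← Finset.sum_fiberwise Finset.univ
      (fun (m : Fin δ → Fin (2 ^ s)) => (fun i : {i // i ∈ S} => m i.1))]
    refine Finset.sum_le_sum fun w _ => ?_
    calc _ = ∑ m ∈ Finset.univ.filter
          (fun m : Fin δ → Fin (2 ^ s) => (fun i : {i // i ∈ S} => m i.1) = w),
            e x m * ((g w x : ℝ))⁻¹ := by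
          refine Finset.sum_congr rfl fun m hm => ?_
          rw [(Finset.mem_filter.1 hm).2]
      _ ≤ _ := by
          rw [← Finset.sum_mul]
          exact mul_le_mul_of_nonneg_right (hec x w) (by positivity)
  calc _ ≤ ∑ x, ∑ w : {i // i ∈ S} → Fin (2 ^ s), c * ((g w x : ℝ))⁻¹ :=
        Finset.sum_le_sum fun x _ => hfib x
    _ = ∑ w : {i // i ∈ S} → Fin (2 ^ s), c * ∑ x, ((g w x : ℝ))⁻¹ := by
        rw [Finset.sum_comm]
        simp only [Finset.mul_sum]
    _ ≤ ∑ w : {i // i ∈ S} → Fin (2 ^ s), c * (1 + Real.log (Fintype.card X)) :=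
        Finset.sum_le_sum fun w _ => mul_le_mul_of_nonneg_left (sum_inv_guess_le (hg w)) hc
    _ = _ := by
        rw [Finset.sum_const, nsmul_eq_mul]
        simp [pow_mul]
        ring

/-- A pointwise bound on the cost wherever the encoder has mass bounds the expected cost. -/
lemma sum_mul_encoder_rpow_le {X Y M : Type*} [Fintype X] [Fintype Y] [Fintype M] {ρ : ℝ}
    (hρ : 0 < ρ) {p : X → Y → ℝ} (hp0 : ∀ x y, 0 ≤ p x y) {e : X → Y → M → ℝ}
    (he0 : ∀ x y m, 0 ≤ e x y m) (he1 : ∀ x y, ∑ m, e x y m = 1)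
    {a : X → Y → M → ℕ} {b : X → Y → ℕ} (hab : ∀ x y m, e x y m ≠ 0 → a x y m ≤ b x y) :
    ∑ x, ∑ y, ∑ m, p x y * e x y m * (a x y m : ℝ) ^ ρ ≤
      ∑ x, ∑ y, p x y * (b x y : ℝ) ^ ρ := by
  refine Finset.sum_le_sum fun x _ => Finset.sum_le_sum fun y _ => ?_
  calc _ ≤ ∑ m, p x y * e x y m * (b x y : ℝ) ^ ρ := by
        refine Finset.sum_le_sum fun m _ => ?_
        by_cases h : e x y m = 0
        · simp [h]
        · refine mul_le_mul_of_nonneg_left ?_ (mul_nonneg (hp0 _ _) (he0 _ _ _))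
          exact Real.rpow_le_rpow (by positivity) (by exact_mod_cast hab x y m h) hρ.le
    _ = _ := by rw [← Finset.sum_mul, ← Finset.mul_sum, he1, mul_one]

/-! ### Codes -/

/-- A Reed–Solomon based sharing scheme: any `η + κ` of the `δ` shares determine the key `u` and
the content `c`; for a fixed content, any `η` shares determine the key. -/
lemma exists_sharing_code (η κ δ t : ℕ) (ht : t = 0 ∨ Nat.clog 2 δ ≤ t) :
    ∃ C : (Fin η → Fin (2 ^ t)) → (Fin κ → Fin (2 ^ t)) → Fin δ → Fin (2 ^ t),
      (∀ S : Finset (Fin δ), S.card = η + κ → ∀ u c u' c',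
        (∀ i ∈ S, C u c i = C u' c' i) → u = u' ∧ c = c') ∧
      (∀ S : Finset (Fin δ), S.card = η → ∀ u u' c,
        (∀ i ∈ S, C u c i = C u' c i) → u = u') := by
  by_cases h0 : t = 0
  · subst h0
    have : Subsingleton (Fin (2 ^ 0)) := by rw [pow_zero]; infer_instance
    exact ⟨fun _ _ _ => 0, fun _ _ _ _ _ _ _ => ⟨Subsingleton.elim _ _, Subsingleton.elim _ _⟩,
      fun _ _ _ _ _ _ => Subsingleton.elim _ _⟩
  have hδ : δ ≤ 2 ^ t := (Nat.clog_le_iff_le_pow (by norm_num)).1 (ht.resolve_left h0)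
  have : Fact (Nat.Prime 2) := ⟨Nat.prime_two⟩
  let F := GaloisField 2 t
  have : Fintype F := Fintype.ofFinite F
  have hF : Fintype.card F = 2 ^ t := by
    rw [← Nat.card_eq_fintype_card]
    exact GaloisField.card 2 t h0
  let φ : Fin (2 ^ t) ≃ F := Fintype.equivOfCardEq (by simp [hF])
  let pt : Fin δ → F := fun i => φ (Fin.castLE hδ i)
  have hpt : Function.Injective pt := φ.injective.comp (Fin.castLE_injective hδ)
  have hvan : ∀ {n : ℕ} (S : Finset (Fin δ)), S.card = n → ∀ v : Fin n → F,
      (∀ i ∈ S, ∑ j : Fin n, pt i ^ (j : ℕ) * v j = 0) → v = 0 := by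
    intro n S hS v hv
    exact Matrix.eq_zero_of_forall_index_sum_pow_mul_eq_zero
      (hpt.comp (S.orderEmbOfFin hS).injective) fun j => hv _ (S.orderEmbOfFin_mem hS j)
  refine ⟨fun u c i => φ.symm (∑ j : Fin (η + κ),
    pt i ^ (j : ℕ) * Fin.append (φ ∘ u) (φ ∘ c) j), ?_, ?_⟩
  · intro S hS u c u' c' h
    have hz := hvan S hS (Fin.append (φ ∘ u) (φ ∘ c) - Fin.append (φ ∘ u') (φ ∘ c')) (by
      intro i hi
      simp only [Pi.sub_apply, mul_sub, Finset.sum_sub_distrib, sub_eq_zero]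
      exact φ.symm.injective (h i hi))
    rw [sub_eq_zero] at hz
    constructor
    · ext1 j
      have := congrFun hz (Fin.castAdd κ j)
      simp only [Fin.append_left, Function.comp_apply] at this
      exact φ.injective this
    · ext1 j
      have := congrFun hz (Fin.natAdd η j)
      simp only [Fin.append_right, Function.comp_apply] at this
      exact φ.injective this
  · intro S hS u u' c h
    have hz := hvan S hS (φ ∘ u - φ ∘ u') (by
      intro i hi
      have := φ.symm.injective (h i hi)
      simp only [Fin.sum_univ_add, Fin.append_left, Fin.append_right, add_left_inj] at this
      simpa [mul_sub, Finset.sum_sub_distrib, sub_eq_zero] using this)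
    rw [sub_eq_zero] at hz
    ext1 j
    exact φ.injective (congrFun hz j)

/-- Storing a maximum-distance-separable code on `q` bits and a secret-sharing code on `r` bits
of each disk: any `η + κ` disks determine the content, and for a fixed content any `η` disks
determine the key. -/
lemma exists_disk_code (η κ δ q r : ℕ) (hq : q = 0 ∨ Nat.clog 2 δ ≤ q)
    (hr : r = 0 ∨ Nat.clog 2 δ ≤ r) :
    ∃ C : Fin (2 ^ ((η + κ) * q + κ * r)) → Fin (2 ^ (η * r)) → Fin δ → Fin (2 ^ (q + r)),
      (∀ S : Finset (Fin δ), S.card = η + κ → ∀ z u z' u',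
        (∀ i ∈ S, C z u i = C z' u' i) → z = z') ∧
      (∀ S : Finset (Fin δ), S.card = η → ∀ z u u',
        (∀ i ∈ S, C z u i = C z u' i) → u = u') := by
  obtain ⟨A, hA, -⟩ := exists_sharing_code η κ δ q hq
  obtain ⟨D, hD, hD'⟩ := exists_sharing_code η κ δ r hr
  let ψ : Fin (2 ^ ((η + κ) * q + κ * r)) ≃
      ((Fin η → Fin (2 ^ q)) × (Fin κ → Fin (2 ^ q))) × (Fin κ → Fin (2 ^ r)) :=
    Fintype.equivOfCardEq (by
      simp only [Fintype.card_prod, Fintype.card_fun, Fintype.card_fin]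
      ring)
  let χ : Fin (2 ^ (η * r)) ≃ (Fin η → Fin (2 ^ r)) :=
    Fintype.equivOfCardEq (by
      simp only [Fintype.card_fun, Fintype.card_fin]
      ring)
  let θ : Fin (2 ^ q) × Fin (2 ^ r) ≃ Fin (2 ^ (q + r)) :=
    Fintype.equivOfCardEq (by
      simp only [Fintype.card_prod, Fintype.card_fin]
      ring)
  refine ⟨fun z u i => θ (A (ψ z).1.1 (ψ z).1.2 i, D (χ u) (ψ z).2 i), ?_, ?_⟩
  · intro S hS z u z' u' h
    have h' := fun i hi => Prod.mk.inj (θ.injective (h i hi))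
    obtain ⟨h1, h2⟩ := hA S hS _ _ _ _ fun i hi => (h' i hi).1
    obtain ⟨-, h3⟩ := hD S hS _ _ _ _ fun i hi => (h' i hi).2
    exact ψ.injective (Prod.ext (Prod.ext h1 h2) h3)
  · intro S hS z u u' h
    have h' := fun i hi => Prod.mk.inj (θ.injective (h i hi))
    exact χ.injective (hD' S hS _ _ _ fun i hi => (h' i hi).2)

/-! ### The best and the worst subset of disks -/

lemma le_sSup_card {δ n : ℕ} (F : Finset (Fin δ) → ℕ) {B : Finset (Fin δ)} (hB : B.card = n) :
    F B ≤ sSup {k : ℕ | ∃ B : Finset (Fin δ), B.card = n ∧ k = F B} := by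
  refine le_csSup (Set.Finite.bddAbove ((Set.finite_range F).subset ?_)) ⟨B, hB, rfl⟩
  rintro k ⟨B, -, rfl⟩
  exact ⟨B, rfl⟩

lemma sSup_card_le {δ n b : ℕ} {F : Finset (Fin δ) → ℕ}
    (h : ∀ B : Finset (Fin δ), B.card = n → F B ≤ b) :
    sSup {k : ℕ | ∃ B : Finset (Fin δ), B.card = n ∧ k = F B} ≤ b := by
  refine csSup_le' ?_
  rintro k ⟨B, hB, rfl⟩
  exact h B hB

lemma sInf_card_le {δ n : ℕ} (F : Finset (Fin δ) → ℕ) {B : Finset (Fin δ)} (hB : B.card = n) :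
    sInf {k : ℕ | ∃ B : Finset (Fin δ), B.card = n ∧ k = F B} ≤ F B :=
  Nat.sInf_le ⟨B, hB, rfl⟩

lemma exists_finset_card_eq {δ n : ℕ} (hn : n ≤ δ) : ∃ B : Finset (Fin δ), B.card = n := by
  obtain ⟨B, -, hB⟩ := Finset.exists_subset_card_eq (s := (Finset.univ : Finset (Fin δ)))
    (n := n) (by simpa using hn)
  exact ⟨B, hB⟩

lemma exists_sInf_card_eq {δ n : ℕ} (hn : n ≤ δ) (F : Finset (Fin δ) → ℕ) :
    ∃ B : Finset (Fin δ), B.card = n ∧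
      sInf {k : ℕ | ∃ B : Finset (Fin δ), B.card = n ∧ k = F B} = F B := by
  obtain ⟨B, hB⟩ := exists_finset_card_eq hn
  exact Nat.sInf_mem (s := {k : ℕ | ∃ B : Finset (Fin δ), B.card = n ∧ k = F B})
    ⟨F B, B, hB, rfl⟩

/-- Guessing with the hints in `E ⊆ B` by running through the guesses with the hints in `B` for
all values of the missing hints. -/
lemma exists_guess_of_subset {X Y : Type*} [Fintype X] {δ s : ℕ}
    {E B : Finset (Fin δ)} (hEB : E ⊆ B)
    {G : Y × ({i // i ∈ B} → Fin (2 ^ s)) → X → ℕ} (hG : IsGuess G) :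
    ∃ G' : Y × ({i // i ∈ E} → Fin (2 ^ s)) → X → ℕ, IsGuess G' ∧
      ∀ x y (m : Fin δ → Fin (2 ^ s)), G' (y, fun i => m i.1) x ≤
        2 ^ (s * (B.card - E.card)) * G (y, fun i => m i.1) x := by
  classical
  let ext : ({i // i ∈ E} → Fin (2 ^ s)) → ({i // i ∈ B \ E} → Fin (2 ^ s)) →
      {i // i ∈ B} → Fin (2 ^ s) := fun w w' i =>
    if h : i.1 ∈ E then w ⟨i.1, h⟩ else w' ⟨i.1, Finset.mem_sdiff.2 ⟨i.2, h⟩⟩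
  have hne : (Finset.univ : Finset ({i // i ∈ B \ E} → Fin (2 ^ s))).Nonempty :=
    ⟨fun _ => ⟨0, by positivity⟩, Finset.mem_univ _⟩
  choose g hg hg' using fun v : Y × ({i // i ∈ E} → Fin (2 ^ s)) =>
    exists_guess_le_card fun x => Finset.univ.inf' hne fun w' => G (v.1, ext v.2 w') x
  refine ⟨g, hg, fun x y m => (hg' _ x).trans ?_⟩
  set k := G (y, fun i => m i.1) x
  have hcard : (Finset.univ : Finset ({i // i ∈ B \ E} → Fin (2 ^ s))).card =
      2 ^ (s * (B.card - E.card)) := by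
    rw [Finset.card_univ, Fintype.card_fun, Fintype.card_fin, Fintype.card_coe,
      Finset.card_sdiff_of_subset hEB, pow_mul]
  rw [← hcard]
  refine (Finset.card_le_card (t := Finset.univ.biUnion fun w' =>
    Finset.univ.filter fun x' => G (y, ext (fun i => m i.1) w') x' ≤ k) ?_).trans
      (Finset.card_biUnion_le_card_mul _ _ _ fun w' _ => ?_)
  · intro x' hx'
    have h1 := (Finset.mem_filter.1 hx').2
    have h2 : Finset.univ.inf' hne (fun w' => G (y, ext (fun i => m i.1) w') x) ≤ k := by
      refine (Finset.inf'_le _ (Finset.mem_univ fun i => m i.1)).trans (le_of_eq ?_)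
      congr 2
      ext1 i
      by_cases h : i.1 ∈ E <;> simp [ext, h]
    obtain ⟨w', -, hw'⟩ := Finset.exists_mem_eq_inf' hne
      fun w' => G (y, ext (fun i => m i.1) w') x'
    refine Finset.mem_biUnion.2 ⟨w', Finset.mem_univ _, ?_⟩
    simp only [Finset.mem_filter, Finset.mem_univ, true_and]
    exact hw'.symm.le.trans (h1.trans h2)
  · calc _ ≤ (Finset.Icc 1 k).card := by
          refine Finset.card_le_card_of_injOn (G (y, ext (fun i => m i.1) w')) ?_ ?_
          · intro x' hx'
            have := hG.one_le (y, ext (fun i => m i.1) w') x'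
            have h1 := (Finset.mem_filter.1 hx').2
            simpa using ⟨this, h1⟩
          · exact (hG _).injOn.mono (Set.subset_univ _)
      _ = k := by simp

/-! ### The coded encoder -/

section CodeEncoder

variable {𝒳 𝒴 : Type*} {δ s N U : ℕ}

/-- The encoder that stores the codeword with content `z x y` and a uniformly drawn key. -/
def codeEncoder (C : Fin N → Fin U → Fin δ → Fin (2 ^ s)) (z : 𝒳 → 𝒴 → Fin N) (x : 𝒳) (y : 𝒴)
    (m : Fin δ → Fin (2 ^ s)) : ℝ :=
  ∑ u, if C (z x y) u = m then (U : ℝ)⁻¹ else 0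

lemma codeEncoder_nonneg (C : Fin N → Fin U → Fin δ → Fin (2 ^ s)) (z : 𝒳 → 𝒴 → Fin N) (x : 𝒳)
    (y : 𝒴) (m : Fin δ → Fin (2 ^ s)) : 0 ≤ codeEncoder C z x y m :=
  Finset.sum_nonneg fun u _ => by split_ifs <;> positivity

lemma sum_codeEncoder (hU : U ≠ 0) (C : Fin N → Fin U → Fin δ → Fin (2 ^ s))
    (z : 𝒳 → 𝒴 → Fin N) (x : 𝒳) (y : 𝒴) : ∑ m, codeEncoder C z x y m = 1 := by
  unfold codeEncoder
  rw [Finset.sum_comm]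
  simp [hU]

lemma exists_of_codeEncoder_ne_zero {C : Fin N → Fin U → Fin δ → Fin (2 ^ s)}
    {z : 𝒳 → 𝒴 → Fin N} {x : 𝒳} {y : 𝒴} {m : Fin δ → Fin (2 ^ s)}
    (h : codeEncoder C z x y m ≠ 0) : ∃ u, C (z x y) u = m := by
  obtain ⟨u, -, hu⟩ := Finset.exists_ne_zero_of_sum_ne_zero h
  exact ⟨u, by by_contra h'; simp [h'] at hu⟩

lemma sum_filter_codeEncoder_le {C : Fin N → Fin U → Fin δ → Fin (2 ^ s)} {B : Finset (Fin δ)}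
    (hC : ∀ z u u', (∀ i ∈ B, C z u i = C z u' i) → u = u') (z : 𝒳 → 𝒴 → Fin N) (x : 𝒳) (y : 𝒴)
    (w : {i // i ∈ B} → Fin (2 ^ s)) :
    ∑ m ∈ Finset.univ.filter (fun m : Fin δ → Fin (2 ^ s) => (fun i : {i // i ∈ B} => m i.1) = w),
      codeEncoder C z x y m ≤ (U : ℝ)⁻¹ := by
  unfold codeEncoder
  rw [Finset.sum_comm]
  simp only [Finset.sum_ite_eq, Finset.mem_filter, Finset.mem_univ, true_and]
  rw [← Finset.sum_filter, Finset.sum_const, nsmul_eq_mul]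
  refine mul_le_of_le_one_left (by positivity) ?_
  have : (Finset.univ.filter fun u => (fun i : {i // i ∈ B} => C (z x y) u i.1) = w).card ≤ 1 := by
    refine Finset.card_le_one.2 fun u hu u' hu' => hC (z x y) u u' fun i hi => ?_
    have h := (Finset.mem_filter.1 hu).2.trans (Finset.mem_filter.1 hu').2.symm
    exact congrFun h ⟨i, hi⟩
  exact_mod_cast this

end CodeEncoder

/-! ### Bounds on the two ambiguities -/

section Ambiguity

variable {𝒳 𝒴 : Type*} [Fintype 𝒳] [Fintype 𝒴] {δ n s N U : ℕ} {ρ : ℝ} {p : 𝒳 → 𝒴 → ℝ}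
  {e : 𝒳 → 𝒴 → (Fin δ → Fin (2 ^ s)) → ℝ}

lemma sum_mul_rpow_nonneg {X Y M : Type*} [Fintype X] [Fintype Y] [Fintype M]
    {p : X → Y → ℝ} (hp0 : ∀ x y, 0 ≤ p x y) {e : X → Y → M → ℝ} (he0 : ∀ x y m, 0 ≤ e x y m)
    (a : X → Y → M → ℕ) : 0 ≤ ∑ x, ∑ y, ∑ m, p x y * e x y m * (a x y m : ℝ) ^ ρ :=
  Finset.sum_nonneg fun _ _ => Finset.sum_nonneg fun _ _ => Finset.sum_nonneg fun _ _ =>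
    mul_nonneg (mul_nonneg (hp0 _ _) (he0 _ _ _)) (Real.rpow_nonneg (Nat.cast_nonneg _) _)

lemma le_bobGuessAmbDF {c : ℝ}
    (h : ∀ G : (B : Finset (Fin δ)) → 𝒴 × ({i // i ∈ B} → Fin (2 ^ s)) → 𝒳 → ℕ,
      (∀ B : Finset (Fin δ), B.card = n → IsGuess (G B)) →
      c ≤ ∑ x : 𝒳, ∑ y : 𝒴, ∑ m : Fin δ → Fin (2 ^ s), p x y * e x y m *
        ((sSup {k : ℕ | ∃ B : Finset (Fin δ), B.card = n ∧
            k = G B (y, fun i => m i.1) x} : ℕ) : ℝ) ^ ρ) :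
    c ≤ bobGuessAmbDF δ n s ρ p e := by
  refine le_csInf ?_ ?_
  · choose G hG using fun B : Finset (Fin δ) =>
      exists_isGuess 𝒳 (𝒴 × ({i // i ∈ B} → Fin (2 ^ s)))
    exact ⟨_, G, fun B _ => hG B, rfl⟩
  · rintro r ⟨G, hG, rfl⟩
    exact h G hG

lemma le_eveAmbDF {c : ℝ}
    (h : ∀ G : (B : Finset (Fin δ)) → 𝒴 × ({i // i ∈ B} → Fin (2 ^ s)) → 𝒳 → ℕ,
      (∀ B : Finset (Fin δ), B.card = n → IsGuess (G B)) →
      c ≤ ∑ x : 𝒳, ∑ y : 𝒴, ∑ m : Fin δ → Fin (2 ^ s), p x y * e x y m *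
        ((sInf {k : ℕ | ∃ B : Finset (Fin δ), B.card = n ∧
            k = G B (y, fun i => m i.1) x} : ℕ) : ℝ) ^ ρ) :
    c ≤ eveAmbDF δ n s ρ p e := by
  refine le_csInf ?_ ?_
  · choose G hG using fun B : Finset (Fin δ) =>
      exists_isGuess 𝒳 (𝒴 × ({i // i ∈ B} → Fin (2 ^ s)))
    exact ⟨_, G, fun B _ => hG B, rfl⟩
  · rintro r ⟨G, hG, rfl⟩
    exact h G hG

lemma bobGuessAmbDF_le (hp0 : ∀ x y, 0 ≤ p x y) (he0 : ∀ x y m, 0 ≤ e x y m)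
    (G : (B : Finset (Fin δ)) → 𝒴 × ({i // i ∈ B} → Fin (2 ^ s)) → 𝒳 → ℕ)
    (hG : ∀ B : Finset (Fin δ), B.card = n → IsGuess (G B)) :
    bobGuessAmbDF δ n s ρ p e ≤
      ∑ x : 𝒳, ∑ y : 𝒴, ∑ m : Fin δ → Fin (2 ^ s), p x y * e x y m *
        ((sSup {k : ℕ | ∃ B : Finset (Fin δ), B.card = n ∧
            k = G B (y, fun i => m i.1) x} : ℕ) : ℝ) ^ ρ := by
  refine csInf_le ⟨0, ?_⟩ ⟨G, hG, rfl⟩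
  rintro r ⟨G, -, rfl⟩
  exact sum_mul_rpow_nonneg hp0 he0 _

lemma eveAmbDF_le (hp0 : ∀ x y, 0 ≤ p x y) (he0 : ∀ x y m, 0 ≤ e x y m)
    (G : (B : Finset (Fin δ)) → 𝒴 × ({i // i ∈ B} → Fin (2 ^ s)) → 𝒳 → ℕ)
    (hG : ∀ B : Finset (Fin δ), B.card = n → IsGuess (G B)) :
    eveAmbDF δ n s ρ p e ≤
      ∑ x : 𝒳, ∑ y : 𝒴, ∑ m : Fin δ → Fin (2 ^ s), p x y * e x y m *
        ((sInf {k : ℕ | ∃ B : Finset (Fin δ), B.card = n ∧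
            k = G B (y, fun i => m i.1) x} : ℕ) : ℝ) ^ ρ := by
  refine csInf_le ⟨0, ?_⟩ ⟨G, hG, rfl⟩
  rintro r ⟨G, -, rfl⟩
  exact sum_mul_rpow_nonneg hp0 he0 _

lemma one_le_bobGuessAmbDF (hρ : 0 < ρ) (hp0 : ∀ x y, 0 ≤ p x y) (hp1 : ∑ x, ∑ y, p x y = 1)
    (he0 : ∀ x y m, 0 ≤ e x y m) (he1 : ∀ x y, ∑ m, e x y m = 1) (hn : n ≤ δ) :
    1 ≤ bobGuessAmbDF δ n s ρ p e := by
  refine le_bobGuessAmbDF fun G hG => ?_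
  obtain ⟨B, hB⟩ := exists_finset_card_eq hn
  calc (1 : ℝ) = ∑ x, ∑ y, ∑ m, p x y * e x y m := by
        simp only [← Finset.mul_sum, he1, mul_one, hp1]
    _ ≤ _ := by
      refine Finset.sum_le_sum fun x _ => Finset.sum_le_sum fun y _ =>
        Finset.sum_le_sum fun m _ => ?_
      refine le_mul_of_one_le_right (mul_nonneg (hp0 _ _) (he0 _ _ _)) (Real.one_le_rpow ?_ hρ.le)
      exact_mod_cast ((hG B hB).one_le (y, fun i => m i.1) x).trans
        (le_sSup_card (fun B => G B (y, fun i => m i.1) x) hB)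

lemma one_add_log_card_pos (hp1 : ∑ x, ∑ y, p x y = 1) :
    0 < 1 + Real.log (Fintype.card 𝒳) := by
  have : Nonempty 𝒳 := by
    by_contra h
    rw [not_nonempty_iff] at h
    simp at hp1
  have h1 : (1 : ℝ) ≤ Fintype.card 𝒳 := by exact_mod_cast Fintype.card_pos
  have := Real.log_nonneg h1
  linarith

lemma condRenyi_le_bobGuessAmbDF (hρ : 0 < ρ) (hp0 : ∀ x y, 0 ≤ p x y)
    (hp1 : ∑ x, ∑ y, p x y = 1) (he0 : ∀ x y m, 0 ≤ e x y m) (he1 : ∀ x y, ∑ m, e x y m = 1)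
    (hn : n ≤ δ) :
    (2 : ℝ) ^ (ρ * condRenyi ρ p) / (2 ^ (s * n) * (1 + Real.log (Fintype.card 𝒳))) ^ ρ ≤
      bobGuessAmbDF δ n s ρ p e := by
  have hL := one_add_log_card_pos hp1
  refine le_bobGuessAmbDF fun G hG => ?_
  obtain ⟨B, hB⟩ := exists_finset_card_eq hn
  rw [div_le_iff₀ (by positivity)]
  have hle : ∀ x y (m : Fin δ → Fin (2 ^ s)), G B (y, fun i => m i.1) x ≤
      sSup {k : ℕ | ∃ B : Finset (Fin δ), B.card = n ∧ k = G B (y, fun i => m i.1) x} :=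
    fun x y m => le_sSup_card (fun B => G B (y, fun i => m i.1) x) hB
  have hone : ∀ x y (m : Fin δ → Fin (2 ^ s)), 0 < G B (y, fun i => m i.1) x :=
    fun x y m => (hG B hB).one_le _ x
  refine two_rpow_condRenyi_le_moment_mul hρ hp0 hp1 he0 he1
    (a := fun x y m => ((sSup {k : ℕ | ∃ B : Finset (Fin δ), B.card = n ∧
      k = G B (y, fun i => m i.1) x} : ℕ) : ℝ))
    (fun x y m => by exact_mod_cast (hone x y m).trans_le (hle x y m)) fun y => ?_
  have h := sum_inv_guess_of_hints_le B (e := fun x => e x y) zero_le_one (fun x w => ?_)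
    (g := fun w => G B (y, w)) (fun w => hG B hB (y, w))
  · rw [hB, one_mul] at h
    refine le_trans ?_ h
    refine Finset.sum_le_sum fun x _ => Finset.sum_le_sum fun m _ => ?_
    refine mul_le_mul_of_nonneg_left ?_ (he0 _ _ _)
    exact inv_anti₀ (by exact_mod_cast hone x y m) (by exact_mod_cast hle x y m)
  · rw [← he1 x y]
    exact Finset.sum_le_univ_sum_of_nonneg fun m => he0 x y m

/-- If given `(x, y)` any `n` hints take each value with probability at most `c`, Eve's best
choice of `n` out of `δ` hints helps her by a factor `c * (δ * 2 ^ s) ^ n` at most. -/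
lemma condRenyi_le_eveAmbDF (hρ : 0 < ρ) (hp0 : ∀ x y, 0 ≤ p x y)
    (hp1 : ∑ x, ∑ y, p x y = 1) (he0 : ∀ x y m, 0 ≤ e x y m) (he1 : ∀ x y, ∑ m, e x y m = 1)
    (hn : n ≤ δ) (hδ : 0 < δ) {c : ℝ} (hc : 0 < c)
    (hec : ∀ (B : Finset (Fin δ)), B.card = n → ∀ x y (w : {i // i ∈ B} → Fin (2 ^ s)),
      ∑ m ∈ Finset.univ.filter (fun m : Fin δ → Fin (2 ^ s) => (fun i : {i // i ∈ B} => m i.1) = w),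
        e x y m ≤ c) :
    (2 : ℝ) ^ (ρ * condRenyi ρ p) /
      (δ ^ n * (c * 2 ^ (s * n) * (1 + Real.log (Fintype.card 𝒳)))) ^ ρ ≤
      eveAmbDF δ n s ρ p e := by
  have hL := one_add_log_card_pos hp1
  have hδ' : (0 : ℝ) < δ := by exact_mod_cast hδ
  refine le_eveAmbDF fun G hG => ?_
  rw [div_le_iff₀ (by positivity)]
  have hex : ∀ x y (m : Fin δ → Fin (2 ^ s)), ∃ B : Finset (Fin δ), B.card = n ∧
      sInf {k : ℕ | ∃ B : Finset (Fin δ), B.card = n ∧ k = G B (y, fun i => m i.1) x} =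
        G B (y, fun i => m i.1) x :=
    fun x y m => exists_sInf_card_eq hn fun B => G B (y, fun i => m i.1) x
  refine two_rpow_condRenyi_le_moment_mul hρ hp0 hp1 he0 he1
    (a := fun x y m => ((sInf {k : ℕ | ∃ B : Finset (Fin δ), B.card = n ∧
      k = G B (y, fun i => m i.1) x} : ℕ) : ℝ)) (fun x y m => ?_) fun y => ?_
  · obtain ⟨B, hB, h⟩ := hex x y m
    rw [h]
    exact_mod_cast (hG B hB).one_le _ x
  · let 𝓔 : Finset (Finset (Fin δ)) := Finset.powersetCard n Finset.univ
    have hmem : ∀ {B}, B ∈ 𝓔 ↔ B.card = n := by simp [𝓔, Finset.mem_powersetCard]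
    calc _ ≤ ∑ x, ∑ m, ∑ B ∈ 𝓔, e x y m * ((G B (y, fun i => m i.1) x : ℝ))⁻¹ := by
          refine Finset.sum_le_sum fun x _ => Finset.sum_le_sum fun m _ => ?_
          obtain ⟨B, hB, h⟩ := hex x y m
          simp only [h]
          exact Finset.single_le_sum
            (f := fun B => e x y m * ((G B (y, fun i => m i.1) x : ℝ))⁻¹)
            (fun B _ => mul_nonneg (he0 _ _ _) (by positivity)) (hmem.2 hB)
      _ = ∑ B ∈ 𝓔, ∑ x, ∑ m, e x y m * ((G B (y, fun i => m i.1) x : ℝ))⁻¹ := by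
          rw [Finset.sum_comm (s := 𝓔)]
          exact Finset.sum_congr rfl fun x _ => Finset.sum_comm
      _ ≤ ∑ B ∈ 𝓔, c * 2 ^ (s * n) * (1 + Real.log (Fintype.card 𝒳)) := by
          refine Finset.sum_le_sum fun B hB => ?_
          rw [hmem] at hB
          have h := sum_inv_guess_of_hints_le B (e := fun x => e x y) hc.le
            (fun x w => hec B hB x y w) (g := fun w => G B (y, w)) (fun w => hG B hB (y, w))
          rwa [hB] at h
      _ ≤ _ := by
          rw [Finset.sum_const, nsmul_eq_mul]
          refine mul_le_mul_of_nonneg_right ?_ (by positivity)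
          rw [Finset.card_powersetCard, Finset.card_univ, Fintype.card_fin]
          exact_mod_cast Nat.choose_le_pow δ n

lemma eveAmbDF_le_condRenyi (hρ : 0 < ρ) (hp0 : ∀ x y, 0 ≤ p x y)
    (hp1 : ∑ x, ∑ y, p x y = 1) (he0 : ∀ x y m, 0 ≤ e x y m) (he1 : ∀ x y, ∑ m, e x y m = 1)
    (hn : n ≤ δ) : eveAmbDF δ n s ρ p e ≤ (2 : ℝ) ^ (ρ * condRenyi ρ p) := by
  choose g hg hg' using fun y => exists_guess_le_card fun x => -p x y
  obtain ⟨B, hB⟩ := exists_finset_card_eq hn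
  refine (eveAmbDF_le hp0 he0 (fun _ v => g v.1) fun _ _ v => hg v.1).trans ?_
  refine (sum_mul_encoder_rpow_le hρ hp0 he0 he1 (b := fun x y => g y x) fun x y m _ => ?_).trans ?_
  · exact sInf_card_le (fun _ => g y x) hB
  · rw [two_rpow_mul_condRenyi hρ hp0 hp1, Finset.sum_comm]
    exact Finset.sum_le_sum fun y _ => sum_mul_guess_rpow_le hρ (fun x => hp0 x y) (hg' y)

lemma eveAmbDF_le_bobGuessAmbDF (hρ : 0 < ρ) (hp0 : ∀ x y, 0 ≤ p x y)
    (he0 : ∀ x y m, 0 ≤ e x y m) {ν : ℕ} (hnν : n ≤ ν) (hν : ν ≤ δ) :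
    eveAmbDF δ n s ρ p e ≤
      ((2 : ℝ) ^ (s * (ν - n))) ^ ρ * bobGuessAmbDF δ ν s ρ p e := by
  classical
  rw [← div_le_iff₀' (by positivity)]
  refine le_bobGuessAmbDF fun G hG => ?_
  obtain ⟨B, hB⟩ := exists_finset_card_eq hν
  obtain ⟨E, hEB, hE⟩ := Finset.exists_subset_card_eq (s := B) (n := n) (by omega)
  obtain ⟨G₁, hG₁, hle⟩ := exists_guess_of_subset hEB (hG B hB)
  choose G₀ hG₀ using fun C : Finset (Fin δ) =>
    exists_isGuess 𝒳 (𝒴 × ({i // i ∈ C} → Fin (2 ^ s)))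
  rw [div_le_iff₀' (by positivity)]
  refine (eveAmbDF_le hp0 he0 (Function.update G₀ E G₁) fun C _ => ?_).trans ?_
  · by_cases h : C = E
    · subst h
      simpa using hG₁
    · simpa [Function.update_of_ne h] using hG₀ C
  · simp only [Finset.mul_sum]
    refine Finset.sum_le_sum fun x _ => Finset.sum_le_sum fun y _ => Finset.sum_le_sum fun m _ => ?_
    rw [mul_left_comm, ← Real.mul_rpow (by positivity) (by positivity)]
    refine mul_le_mul_of_nonneg_left ?_ (mul_nonneg (hp0 _ _) (he0 _ _ _))
    refine Real.rpow_le_rpow (by positivity) ?_ hρ.le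
    have h1 := sInf_card_le (fun C => Function.update G₀ E G₁ C (y, fun i => m i.1) x) hE
    have h2 := le_sSup_card (fun C => G C (y, fun i => m i.1) x) hB
    have h3 := hle x y m
    rw [hB, hE] at h3
    simp only [Function.update_self] at h1
    exact_mod_cast h1.trans (h3.trans (Nat.mul_le_mul_left _ h2))

/-- If any `n` disks determine the content, Bob needs at most `d x y / N + 1` guesses, where
`d x y` is the position of `x` in a fixed guessing order and the content is `d x y` modulo `N`. -/
lemma bobGuessAmbDF_codeEncoder_le (hρ : 0 < ρ) (hp0 : ∀ x y, 0 ≤ p x y) (hU : U ≠ 0)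
    {C : Fin N → Fin U → Fin δ → Fin (2 ^ s)}
    (hC : ∀ S : Finset (Fin δ), S.card = n → ∀ z u z' u',
      (∀ i ∈ S, C z u i = C z' u' i) → z = z')
    {d : 𝒳 → 𝒴 → ℕ} (hd : ∀ y, Function.Injective fun x => d x y)
    (hdlt : ∀ x y, d x y < Fintype.card 𝒳) {z : 𝒳 → 𝒴 → Fin N}
    (hz : ∀ x y, (z x y : ℕ) = d x y % N) :
    bobGuessAmbDF δ n s ρ p (codeEncoder C z) ≤
      ∑ x, ∑ y, p x y * ((d x y / N + 1 : ℕ) : ℝ) ^ ρ := by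
  classical
  choose g hg hg' using fun (B : Finset (Fin δ)) (v : 𝒴 × ({i // i ∈ B} → Fin (2 ^ s))) =>
    exists_guess_le_card fun x => if ∃ u, (fun i : {i // i ∈ B} => C (z x v.1) u i.1) = v.2
      then d x v.1 else Fintype.card 𝒳
  refine (bobGuessAmbDF_le hp0 (codeEncoder_nonneg C z) g fun B _ => hg B).trans ?_
  refine sum_mul_encoder_rpow_le hρ hp0 (codeEncoder_nonneg C z) (sum_codeEncoder hU C z)
    (b := fun x y => d x y / N + 1) fun x y m hm => ?_
  obtain ⟨u, rfl⟩ := exists_of_codeEncoder_ne_zero hm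
  refine sSup_card_le (F := fun B => g B (y, fun i => C (z x y) u i.1) x) fun B hB => ?_
  refine (hg' B _ x).trans ?_
  have hx : ∃ u', (fun i : {i // i ∈ B} => C (z x y) u' i.1) = fun i => C (z x y) u i.1 := ⟨u, rfl⟩
  have hmem : ∀ x', x' ∈ (Finset.univ.filter fun x' =>
      (if ∃ u', (fun i : {i // i ∈ B} => C (z x' y) u' i.1) = fun i => C (z x y) u i.1
        then d x' y else Fintype.card 𝒳) ≤
      (if ∃ u', (fun i : {i // i ∈ B} => C (z x y) u' i.1) = fun i => C (z x y) u i.1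
        then d x y else Fintype.card 𝒳)) → d x' y ≤ d x y ∧ d x' y % N = d x y % N := by
    intro x' hx'
    have h := (Finset.mem_filter.1 hx').2
    rw [if_pos hx] at h
    split_ifs at h with h'
    · obtain ⟨u', hu'⟩ := h'
      refine ⟨h, ?_⟩
      rw [← hz, ← hz, hC B hB _ _ _ _ fun i hi => congrFun hu' ⟨i, hi⟩]
    · exact absurd h (not_le.2 (hdlt x y))
  calc _ ≤ (Finset.range (d x y / N + 1)).card := by
        refine Finset.card_le_card_of_injOn (fun x' => d x' y / N) ?_ ?_
        · intro x' hx'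
          have := Nat.div_le_div_right (c := N) (hmem x' hx').1
          simpa [Nat.lt_succ_iff] using this
        · intro a ha b hb hab
          have ha' := (hmem a ha).2
          have hb' := (hmem b hb).2
          refine hd y ?_
          simp only at hab ⊢
          rw [← Nat.div_add_mod (d a y) N, ← Nat.div_add_mod (d b y) N, hab, ha', hb']
    _ = _ := by simp

lemma div_add_one_rpow_lt (hρ : 0 < ρ) (hN : 0 < N) (k : ℕ) :
    ((k / N + 1 : ℕ) : ℝ) ^ ρ < 1 + (2 / N) ^ ρ * ((k + 1 : ℕ) : ℝ) ^ ρ := by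
  have hN' : (0 : ℝ) < N := by exact_mod_cast hN
  have hpos : 0 < (2 / (N : ℝ)) ^ ρ * ((k + 1 : ℕ) : ℝ) ^ ρ := by positivity
  rcases Nat.eq_zero_or_pos (k / N) with h | h
  · rw [h]
    simpa using hpos
  · have hle : ((k / N + 1 : ℕ) : ℝ) ≤ 2 / N * ((k + 1 : ℕ) : ℝ) := by
      rw [div_mul_eq_mul_div, le_div_iff₀ hN']
      have h2 : (k / N + 1) * N ≤ 2 * (k + 1) := by
        have := Nat.div_mul_le_self k N
        nlinarith
      exact_mod_cast h2
    have := Real.rpow_le_rpow (by positivity) hle hρ.le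
    rw [Real.mul_rpow (by positivity) (by positivity)] at this
    linarith

lemma exists_bobGuessAmbDF_codeEncoder_lt (hρ : 0 < ρ) (hp0 : ∀ x y, 0 ≤ p x y)
    (hp1 : ∑ x, ∑ y, p x y = 1) (hU : U ≠ 0) (hN : 0 < N)
    {C : Fin N → Fin U → Fin δ → Fin (2 ^ s)}
    (hC : ∀ S : Finset (Fin δ), S.card = n → ∀ z u z' u',
      (∀ i ∈ S, C z u i = C z' u' i) → z = z') :
    ∃ z : 𝒳 → 𝒴 → Fin N, bobGuessAmbDF δ n s ρ p (codeEncoder C z) <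
      1 + (2 / N) ^ ρ * (2 : ℝ) ^ (ρ * condRenyi ρ p) := by
  choose g hg hg' using fun y => exists_guess_le_card fun x => -p x y
  have hg1 : ∀ x y, 1 ≤ g y x ∧ g y x ≤ Fintype.card 𝒳 := fun x y =>
    (hg y).mapsTo (Set.mem_univ x)
  refine ⟨fun x y => ⟨(g y x - 1) % N, Nat.mod_lt _ hN⟩, ?_⟩
  refine (bobGuessAmbDF_codeEncoder_le hρ hp0 hU hC (d := fun x y => g y x - 1) ?_ ?_
    fun x y => rfl).trans_lt ?_
  · intro y a b h
    have ha := hg1 a y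
    have hb := hg1 b y
    refine (hg y).injOn (Set.mem_univ _) (Set.mem_univ _) ?_
    simp only at h
    omega
  · intro x y
    have := hg1 x y
    omega
  · have hlt : ∀ x y, (((g y x - 1) / N + 1 : ℕ) : ℝ) ^ ρ < 1 + (2 / N) ^ ρ * (g y x : ℝ) ^ ρ := by
      intro x y
      have := div_add_one_rpow_lt hρ hN (g y x - 1)
      rwa [Nat.sub_add_cancel (hg1 x y).1] at this
    obtain ⟨x₀, -, hx₀⟩ := Finset.exists_ne_zero_of_sum_ne_zero (by rw [hp1]; exact one_ne_zero)
    obtain ⟨y₀, -, hy₀⟩ := Finset.exists_ne_zero_of_sum_ne_zero hx₀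
    calc _ < ∑ x, ∑ y, p x y * (1 + (2 / N) ^ ρ * (g y x : ℝ) ^ ρ) := by
          refine Finset.sum_lt_sum (fun x _ => Finset.sum_le_sum fun y _ =>
            mul_le_mul_of_nonneg_left (hlt x y).le (hp0 x y)) ⟨x₀, Finset.mem_univ _, ?_⟩
          refine Finset.sum_lt_sum (fun y _ => mul_le_mul_of_nonneg_left (hlt x₀ y).le (hp0 x₀ y))
            ⟨y₀, Finset.mem_univ _, ?_⟩
          exact mul_lt_mul_of_pos_left (hlt x₀ y₀) (lt_of_le_of_ne (hp0 x₀ y₀) (Ne.symm hy₀))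
      _ = 1 + (2 / N) ^ ρ * ∑ x, ∑ y, p x y * (g y x : ℝ) ^ ρ := by
          simp only [mul_add, mul_one, Finset.sum_add_distrib, hp1, Finset.mul_sum]
          simp only [mul_left_comm]
      _ ≤ _ := by
          rw [two_rpow_mul_condRenyi hρ hp0 hp1, Finset.sum_comm]
          gcongr with y _
          exact sum_mul_guess_rpow_le hρ (fun x => hp0 x y) (hg' y)

end Ambiguity

/-- Absorbing a factor into the exponent. -/
lemma two_rpow_mul_add_logb {ρ c : ℝ} (hc : 0 < c) (h : ℝ) :
    (2 : ℝ) ^ (ρ * (h + Real.logb 2 c)) = c ^ ρ * (2 : ℝ) ^ (ρ * h) := by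
  rw [mul_add, Real.rpow_add two_pos, mul_comm ρ (Real.logb 2 c),
    Real.rpow_mul two_pos.le (Real.logb 2 c), Real.rpow_logb two_pos (by norm_num) hc, mul_comm]

/-- Theorem 14 (disk failures, finite-blocklength guessing version). -/
theorem disk_failures_guessing
    {𝒳 𝒴 : Type*} [Fintype 𝒳] [Fintype 𝒴]
    (ρ : ℝ) (hρ : 0 < ρ)
    (p : 𝒳 → 𝒴 → ℝ) (hp0 : ∀ x y, 0 ≤ p x y) (hp1 : ∑ x : 𝒳, ∑ y : 𝒴, p x y = 1)
    (δ ν η s : ℕ) (hη : 0 < η) (hην : η < ν) (hνδ : ν ≤ δ) (hs : 0 < s) :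
    (∀ q r : ℕ, q + r = s →
      (q = 0 ∨ Nat.clog 2 δ ≤ q) → (r = 0 ∨ Nat.clog 2 δ ≤ r) →
      ∃ e : 𝒳 → 𝒴 → (Fin δ → Fin (2 ^ s)) → ℝ,
        (∀ x y m, 0 ≤ e x y m) ∧ (∀ x y, ∑ m : Fin δ → Fin (2 ^ s), e x y m = 1) ∧
        bobGuessAmbDF δ ν s ρ p e <
          1 + (2 : ℝ) ^ (ρ * (condRenyi ρ p - (ν : ℝ) * (s : ℝ) + (η : ℝ) * (r : ℝ) + 1)) ∧
        (2 : ℝ) ^ (ρ * (condRenyi ρ p - (η : ℝ) * ((s : ℝ) - (r : ℝ)) -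
            (η : ℝ) * Real.logb 2 (δ : ℝ) -
            Real.logb 2 (1 + Real.log (Fintype.card 𝒳)))) ≤
          eveAmbDF δ η s ρ p e) ∧
    (∀ e : 𝒳 → 𝒴 → (Fin δ → Fin (2 ^ s)) → ℝ,
      (∀ x y m, 0 ≤ e x y m) → (∀ x y, ∑ m : Fin δ → Fin (2 ^ s), e x y m = 1) →
      bobGuessAmbDF δ ν s ρ p e ≥
        max ((2 : ℝ) ^ (ρ * (condRenyi ρ p - (ν : ℝ) * (s : ℝ) -
          Real.logb 2 (1 + Real.log (Fintype.card 𝒳))))) 1 ∧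
      eveAmbDF δ η s ρ p e ≤
        min ((2 : ℝ) ^ (ρ * ((ν : ℝ) - (η : ℝ)) * (s : ℝ)) * bobGuessAmbDF δ ν s ρ p e)
          ((2 : ℝ) ^ (ρ * condRenyi ρ p))) := by
  have hδ : 0 < δ := by omega
  have hδ' : (0 : ℝ) < δ := by exact_mod_cast hδ
  have hL := one_add_log_card_pos hp1
  have hlog : ∀ k : ℕ, Real.logb 2 ((2 : ℝ) ^ k) = k := fun k => by
    rw [Real.logb_pow, Real.logb_self_eq_one one_lt_two, mul_one]
  refine ⟨?_, ?_⟩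
  · rintro q r rfl hq hr
    obtain ⟨κ, rfl⟩ := Nat.exists_eq_add_of_le hην.le
    obtain ⟨C, hC, hC'⟩ := exists_disk_code η κ δ q r hq hr
    have hU : 2 ^ (η * r) ≠ 0 := by positivity
    obtain ⟨z, hz⟩ := exists_bobGuessAmbDF_codeEncoder_lt hρ hp0 hp1 hU (by positivity) hC
    refine ⟨codeEncoder C z, codeEncoder_nonneg C z, sum_codeEncoder hU C z, ?_, ?_⟩
    · refine hz.trans_eq ?_
      rw [← two_rpow_mul_add_logb (by positivity)]
      push_cast
      rw [Real.logb_div (by norm_num) (by positivity), hlog,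
        Real.logb_self_eq_one one_lt_two]
      push_cast
      ring_nf
    · refine le_of_eq_of_le ?_ (condRenyi_le_eveAmbDF hρ hp0 hp1 (codeEncoder_nonneg C z)
        (sum_codeEncoder hU C z) (by omega) hδ (by positivity)
        fun B hB => sum_filter_codeEncoder_le (hC' B hB) z)
      rw [div_eq_inv_mul, ← Real.inv_rpow (by positivity),
        ← two_rpow_mul_add_logb (by positivity), Real.logb_inv,
        Real.logb_mul (by positivity) (by positivity), Real.logb_mul (by positivity) hL.ne',
        Real.logb_mul (by positivity) (by positivity), Real.logb_inv, Real.logb_pow]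
      push_cast
      rw [hlog, hlog]
      push_cast
      ring_nf
  · intro e he0 he1
    refine ⟨max_le ?_ (one_le_bobGuessAmbDF hρ hp0 hp1 he0 he1 hνδ),
      le_min ?_ (eveAmbDF_le_condRenyi hρ hp0 hp1 he0 he1 (by omega))⟩
    · refine le_of_eq_of_le ?_ (condRenyi_le_bobGuessAmbDF hρ hp0 hp1 he0 he1 hνδ)
      rw [div_eq_inv_mul, ← Real.inv_rpow (by positivity),
        ← two_rpow_mul_add_logb (by positivity), Real.logb_inv,
        Real.logb_mul (by positivity) hL.ne', hlog]
      push_cast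
      ring_nf
    · refine (eveAmbDF_le_bobGuessAmbDF hρ hp0 he0 hην.le hνδ).trans_eq ?_
      rw [← Real.rpow_natCast, ← Real.rpow_mul two_pos.le]
      push_cast [Nat.cast_sub hην.le]
      ring_nf
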